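/- arXiv:math/0506001 — 2 statements merged into one kernel-verified Lean document; each statement's English description precedes it below -/
import Mathlib

section
/- (Spectral gap, uniform in the conserved quantities.) There exists a universal constant C > 0, independent of k and of y = (y¹, y²) ∈ ℝ², such that for every k ≥ 2, every y ∈ ℝ², and every C¹ function f : ℝ^{2k+1} → ℝ, bounded with bounded first derivatives, with ∫ f dν^c_{y,k} = 0, one has ∫ f² dν^c_{y,k} ≤ C·k⁴·D_{y,k}(f). -/
open MeasureTheory

/-- The coordinate of a box configuration `x : ℝ^{2k+1}` at the lattice site
`j ∈ {−k,…,k}` (with value `0` outside the box). -/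
noncomputable def cfBox (k : ℕ) (x : Fin (2 * k + 1) → ℝ) (j : ℤ) : ℝ :=
  if h : (j + k).toNat < 2 * k + 1 ∧ 0 ≤ j + k then x ⟨(j + k).toNat, h.1⟩ else 0

/-- The unit coordinate vector of the box `ℝ^{2k+1}` at the lattice site `j`. -/
def eSite (k : ℕ) (j : ℤ) : Fin (2 * k + 1) → ℝ := fun i => if (i : ℤ) = j + k then 1 else 0

/-- The direction `e_{j−1} − 2e_j + e_{j+1}` of the vector field `X_j` in the box. -/
def XdirBox (k : ℕ) (j : ℤ) : Fin (2 * k + 1) → ℝ := fun i =>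
  eSite k (j - 1) i - 2 * eSite k j i + eSite k (j + 1) i

/-- The affine subspace `W_{y,k} ⊂ ℝ^{2k+1}` given by
`Σ_{j=−k}^k x_j = (2k+1)y¹` and `Σ_{j=−k}^k j·x_j = k(k+1)y²`. -/
def Wbox (k : ℕ) (y1 y2 : ℝ) : Set (Fin (2 * k + 1) → ℝ) :=
  {x | (∑ i : Fin (2 * k + 1), x i) = (2 * (k : ℝ) + 1) * y1 ∧
       (∑ i : Fin (2 * k + 1), ((i : ℝ) - (k : ℝ)) * x i) = (k : ℝ) * ((k : ℝ) + 1) * y2}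

/-- `ν` is the canonical measure `ν^c_{y,k}`: the translate, by the minimal-norm point
of `W_{y,k}`, of the standard Gaussian measure of the linear subspace `W_{0,k}` with its
induced Euclidean structure — i.e. the image of the standard Gaussian on `ℝ^{2k−1}`
under a linear isometry onto the direction space of `W_{y,k}`, translated by the
minimal-norm point. -/
def IsCanonicalMeasure (k : ℕ) (y1 y2 : ℝ) (ν : Measure (Fin (2 * k + 1) → ℝ)) : Prop :=
  ∃ (p : Fin (2 * k + 1) → ℝ)
    (ι : (Fin (2 * k - 1) → ℝ) →ₗ[ℝ] (Fin (2 * k + 1) → ℝ)),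
      p ∈ Wbox k y1 y2 ∧ (∀ q ∈ Wbox k y1 y2, (∑ i, (p i) ^ 2) ≤ ∑ i, (q i) ^ 2) ∧
      (∀ z, (∑ i, (ι z i) ^ 2) = ∑ i, (z i) ^ 2) ∧
      (Set.range ι = {v | (∑ i, v i) = 0 ∧ (∑ i : Fin (2 * k + 1), ((i : ℝ) - (k : ℝ)) * v i) = 0}) ∧
      ν = Measure.map (fun z => p + ι z)
            (Measure.pi fun _ : Fin (2 * k - 1) => ProbabilityTheory.gaussianReal 0 1)

/-- The Dirichlet form
`D_{y,k}(u) = ½ ∫ Σ_{i=−k+1}^{k−1} a_i(x)·(X_i u(x))² dν^c_{y,k}(x)`. -/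
noncomputable def dirichletForm (a : ℝ × ℝ × ℝ → ℝ) (k : ℕ)
    (ν : Measure (Fin (2 * k + 1) → ℝ)) (u : (Fin (2 * k + 1) → ℝ) → ℝ) : ℝ :=
  (1 / 2) * ∫ x, ∑ j ∈ Finset.Icc (-(k : ℤ) + 1) ((k : ℤ) - 1),
      a (cfBox k x (j - 1), cfBox k x j, cfBox k x (j + 1)) *
        (fderiv ℝ u x (XdirBox k j)) ^ 2 ∂ν

section GaussianPoincare

open ProbabilityTheory Real

/-- Cauchy–Schwarz against the constant function on an interval. -/
lemma sq_intervalIntegral_le_mul_intervalIntegral_sq {g : ℝ → ℝ} (hg : Continuous g) {b : ℝ}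
    (hb : 0 < b) : (∫ t in 0..b, g t) ^ 2 ≤ b * ∫ t in 0..b, g t ^ 2 := by
  set A := ∫ t in 0..b, g t with hA
  have h0 : 0 ≤ ∫ t in 0..b, (b * g t - A) ^ 2 :=
    intervalIntegral.integral_nonneg hb.le fun t _ => sq_nonneg _
  have hi : ∀ φ : ℝ → ℝ, Continuous φ → IntervalIntegrable φ volume 0 b :=
    fun φ hφ => hφ.intervalIntegrable _ _
  have h1 : ∫ t in 0..b, (b * g t - A) ^ 2
      = b ^ 2 * (∫ t in 0..b, g t ^ 2) - 2 * b * A * A + b * A ^ 2 := by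
    have : ∀ t, (b * g t - A) ^ 2 = b ^ 2 * g t ^ 2 - 2 * b * A * g t + A ^ 2 := fun t => by ring
    simp_rw [this]
    rw [intervalIntegral.integral_add (hi _ (by fun_prop)) (hi _ (by fun_prop)),
      intervalIntegral.integral_sub (hi _ (by fun_prop)) (hi _ (by fun_prop)),
      intervalIntegral.integral_const_mul, intervalIntegral.integral_const_mul,
      intervalIntegral.integral_const, ← hA]
    simp
  rw [h1] at h0
  nlinarith

lemma hasDerivAt_comp_rotation_fst {E : Type*} [NormedAddCommGroup E] [NormedSpace ℝ E]
    {g : E → ℝ} (hg : ContDiff ℝ 1 g) (z : E × E) (θ : ℝ) :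
    HasDerivAt (fun t => g (ContinuousLinearMap.rotation t z).1)
      (fderiv ℝ g (ContinuousLinearMap.rotation θ z).1 (ContinuousLinearMap.rotation θ z).2) θ := by
  have h1 : HasDerivAt (fun t : ℝ => cos t • z.1 + sin t • z.2)
      (-sin θ • z.1 + cos θ • z.2) θ :=
    ((hasDerivAt_cos θ).smul_const z.1).add ((hasDerivAt_sin θ).smul_const z.2)
  have h2 := (hg.differentiable one_ne_zero
    (ContinuousLinearMap.rotation θ z).1).hasFDerivAt
  simp only [ContinuousLinearMap.rotation_apply] at h2 ⊢
  exact h2.comp_hasDerivAt θ h1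

lemma sq_sub_le_integral_rotation {E : Type*} [NormedAddCommGroup E] [NormedSpace ℝ E]
    {g : E → ℝ} (hg : ContDiff ℝ 1 g) (z : E × E) :
    (g z.2 - g z.1) ^ 2 ≤ π / 2 * ∫ θ in Set.Ioc 0 (π / 2),
      (fderiv ℝ g (ContinuousLinearMap.rotation θ z).1 (ContinuousLinearMap.rotation θ z).2) ^ 2 := by
  have hfc : Continuous (fderiv ℝ g) := hg.continuous_fderiv one_ne_zero
  have hc : Continuous fun θ : ℝ =>
      fderiv ℝ g (ContinuousLinearMap.rotation θ z).1 (ContinuousLinearMap.rotation θ z).2 := by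
    simp only [ContinuousLinearMap.rotation_apply]
    fun_prop
  have hftc := intervalIntegral.integral_eq_sub_of_hasDerivAt (a := 0) (b := π / 2)
    (fun θ _ => hasDerivAt_comp_rotation_fst hg z θ) (hc.intervalIntegrable _ _)
  have hcs := sq_intervalIntegral_le_mul_intervalIntegral_sq hc pi_div_two_pos
  rw [hftc, intervalIntegral.integral_of_le pi_div_two_pos.le] at hcs
  simpa [ContinuousLinearMap.rotation_apply] using hcs

variable {E : Type*} [NormedAddCommGroup E] [InnerProductSpace ℝ E] [FiniteDimensional ℝ E]
  [MeasurableSpace E] [BorelSpace E]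

lemma integral_sq_dual_stdGaussian (L : StrongDual ℝ E) :
    ∫ y, L y ^ 2 ∂(stdGaussian E) = ‖L‖ ^ 2 := by
  rw [← variance_dual_stdGaussian, variance_of_integral_eq_zero (by fun_prop) (by simp)]

/-- The **Gaussian Poincaré inequality** for bounded `C¹` functions with bounded derivative, with
the (non-optimal but dimension-free) constant given by rotational interpolation. -/
theorem integral_sq_le_integral_sq_norm_fderiv_stdGaussian {g : E → ℝ} (hg : ContDiff ℝ 1 g)
    {M : ℝ} (hM : ∀ x, |g x| ≤ M) (hM' : ∀ x, ‖fderiv ℝ g x‖ ≤ M)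
    (h0 : ∫ x, g x ∂(stdGaussian E) = 0) :
    ∫ x, g x ^ 2 ∂(stdGaussian E)
      ≤ π ^ 2 / 8 * ∫ x, ‖fderiv ℝ g x‖ ^ 2 ∂(stdGaussian E) := by
  set γ := stdGaussian E
  let R : ℝ → E × E →L[ℝ] E × E := ContinuousLinearMap.rotation
  let h : E × E → ℝ := fun z => fderiv ℝ g z.1 z.2
  have hgc : Continuous g := hg.continuous
  have hfc : Continuous (fderiv ℝ g) := hg.continuous_fderiv one_ne_zero
  have hh : Continuous h := by fun_prop
  have hRc : Continuous fun p : (E × E) × ℝ => R p.2 p.1 := by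
    simp only [R, ContinuousLinearMap.rotation_apply]
    fun_prop
  have hb : ∀ φ : E → ℝ, Continuous φ → ∀ c, (∀ x, |φ x| ≤ c) → Integrable φ γ :=
    fun φ hφ c hc => Integrable.of_bound hφ.aestronglyMeasurable c (ae_of_all _ hc)
  have hM0 : 0 ≤ M := (abs_nonneg _).trans (hM 0)
  have hg2 : Integrable (fun x => g x ^ 2) γ := hb _ (by fun_prop) (M ^ 2) fun x => by
    rw [abs_pow]; exact pow_le_pow_left₀ (abs_nonneg _) (hM x) 2
  have hgi : Integrable g γ := hb _ hgc M hM
  have hleft : ∫ z, (g z.2 - g z.1) ^ 2 ∂(γ.prod γ) = 2 * ∫ x, g x ^ 2 ∂γ := by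
    have : ∀ z : E × E, (g z.2 - g z.1) ^ 2 = g z.1 ^ 2 + g z.2 ^ 2 - 2 * (g z.1 * g z.2) :=
      fun z => by ring
    simp_rw [this]
    have h1 : Integrable (fun z : E × E => g z.1 ^ 2) (γ.prod γ) := hg2.comp_fst γ
    have h2 : Integrable (fun z : E × E => g z.2 ^ 2) (γ.prod γ) := hg2.comp_snd γ
    have h3 : Integrable (fun z : E × E => g z.1 ^ 2 + g z.2 ^ 2) (γ.prod γ) := h1.add h2
    rw [integral_sub h3 ((hgi.mul_prod hgi).const_mul 2), integral_add h1 h2, integral_const_mul,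
      integral_prod_mul g g, h0, integral_fun_fst (fun x => g x ^ 2),
      integral_fun_snd (fun x => g x ^ 2)]
    simp
    ring
  have hn2 : Integrable (fun x : E => ‖x‖ ^ 2) γ :=
    (memLp_two_iff_integrable_sq_norm (by fun_prop)).1 IsGaussian.memLp_two_id
  have hdom : Integrable (fun p : (E × E) × ℝ => h (R p.2 p.1) ^ 2)
      ((γ.prod γ).prod (volume.restrict (Set.Ioc 0 (π / 2)))) := by
    have hd : Integrable (fun z : E × E => M ^ 2 * (2 * (‖z.1‖ ^ 2 + ‖z.2‖ ^ 2))) (γ.prod γ) :=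
      (((hn2.comp_fst γ).add (hn2.comp_snd γ)).const_mul 2).const_mul _
    refine (hd.comp_fst (volume.restrict (Set.Ioc 0 (π / 2)))).mono'
      (by have := hh.comp hRc; exact (this.pow 2).aestronglyMeasurable) (ae_of_all _ fun p => ?_)
    have e1 : ‖(R p.2 p.1).2‖ ≤ ‖p.1.1‖ + ‖p.1.2‖ := by
      simp only [R, ContinuousLinearMap.rotation_apply]
      refine (norm_add_le _ _).trans (add_le_add ?_ ?_) <;> rw [norm_smul] <;>
        refine mul_le_of_le_one_left (norm_nonneg _) ?_
      · simpa using abs_sin_le_one p.2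
      · simpa using abs_cos_le_one p.2
    have e2 : ‖h (R p.2 p.1)‖ ≤ M * (‖p.1.1‖ + ‖p.1.2‖) :=
      (ContinuousLinearMap.le_opNorm _ _).trans
        (mul_le_mul (hM' _) e1 (norm_nonneg _) hM0)
    rw [norm_pow]
    refine (pow_le_pow_left₀ (norm_nonneg _) e2 2).trans ?_
    rw [mul_pow]
    exact mul_le_mul_of_nonneg_left (by nlinarith [sq_nonneg (‖p.1.1‖ - ‖p.1.2‖)]) (sq_nonneg _)
  have hpt : ∀ z : E × E, (g z.2 - g z.1) ^ 2
      ≤ π / 2 * ∫ θ in Set.Ioc 0 (π / 2), h (R θ z) ^ 2 :=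
    sq_sub_le_integral_rotation hg
  have hrot : ∀ θ, ∫ z, h (R θ z) ^ 2 ∂(γ.prod γ) = ∫ z, h z ^ 2 ∂(γ.prod γ) := by
    intro θ
    have hmap : (γ.prod γ).map (R θ) = γ.prod γ :=
      IsGaussian.map_rotation_eq_self_of_forall_strongDual_eq_zero
        integral_strongDual_stdGaussian θ
    conv_rhs => rw [← hmap]
    rw [integral_map (R θ).continuous.aemeasurable (by fun_prop)]
  have hnorm : ∫ z, h z ^ 2 ∂(γ.prod γ) = ∫ x, ‖fderiv ℝ g x‖ ^ 2 ∂γ := by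
    rw [integral_prod]
    · simp_rw [h]
      exact integral_congr_ae (ae_of_all _ fun x => integral_sq_dual_stdGaussian _)
    · refine (hn2.comp_snd γ |>.const_mul (M ^ 2)).mono' (by fun_prop) (ae_of_all _ fun z => ?_)
      rw [norm_pow, ← mul_pow]
      exact pow_le_pow_left₀ (norm_nonneg _) ((ContinuousLinearMap.le_opNorm _ _).trans
        (mul_le_mul_of_nonneg_right (hM' _) (norm_nonneg _))) 2
  have key : ∫ z, (g z.2 - g z.1) ^ 2 ∂(γ.prod γ)
      ≤ π / 2 * (π / 2 * ∫ x, ‖fderiv ℝ g x‖ ^ 2 ∂γ) := by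
    calc _ ≤ ∫ z, π / 2 * (∫ θ in Set.Ioc 0 (π / 2), h (R θ z) ^ 2) ∂(γ.prod γ) :=
          integral_mono_of_nonneg (ae_of_all _ fun z => sq_nonneg _)
            (hdom.integral_prod_left.const_mul _) (ae_of_all _ hpt)
      _ = π / 2 * ∫ θ in Set.Ioc 0 (π / 2), (∫ z, h (R θ z) ^ 2 ∂(γ.prod γ)) := by
          rw [integral_const_mul, integral_integral_swap hdom]
      _ = _ := by
          simp_rw [hrot, hnorm]
          simp [max_eq_left pi_div_two_pos.le]
  rw [hleft] at key
  linarith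

end GaussianPoincare

section SecondDifference

/-- Double summation by parts against second differences. -/
lemma sum_second_diff_mul (T g : ℕ → ℝ) (M : ℕ) :
    ∑ i ∈ Finset.range (M + 2), (T (i + 2) - 2 * T (i + 1) + T i) * g i
      = (∑ i ∈ Finset.range M, T (i + 2) * (g i - 2 * g (i + 1) + g (i + 2)))
        + (T (M + 3) * g (M + 1) + T (M + 2) * (g M - 2 * g (M + 1))
          + T 0 * g 0 + T 1 * (g 1 - 2 * g 0)) := by
  induction M with
  | zero => simp [Finset.sum_range_succ]; ring
  | succ M ih => rw [Finset.sum_range_succ, ih, Finset.sum_range_succ _ M]; ring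

/-- Iterated partial sums of a sequence, written as a single weighted sum. -/
lemma sum_range_sum_range (w : ℕ → ℝ) (n : ℕ) :
    ∑ l ∈ Finset.range n, ∑ i ∈ Finset.range l, w i
      = ((n : ℝ) - 1) * (∑ i ∈ Finset.range n, w i) - ∑ i ∈ Finset.range n, (i : ℝ) * w i := by
  induction n with
  | zero => simp
  | succ n ih =>
    rw [Finset.sum_range_succ, ih, Finset.sum_range_succ _ n, Finset.sum_range_succ _ n]
    push_cast
    ring

lemma sq_sum_range_le {w : ℕ → ℝ} {N : ℕ} {V : ℝ} (hw : ∀ m ≤ N, ∑ i ∈ Finset.range m, w i ^ 2 ≤ V)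
    {m : ℕ} (hm : m ≤ N) : (∑ i ∈ Finset.range m, w i) ^ 2 ≤ N * V := by
  have h := sq_sum_le_card_mul_sum_sq (s := Finset.range m) (f := w)
  rw [Finset.card_range] at h
  have h0 : 0 ≤ ∑ i ∈ Finset.range m, w i ^ 2 := Finset.sum_nonneg fun _ _ => sq_nonneg _
  have hmN : (m : ℝ) ≤ N := by exact_mod_cast hm
  exact h.trans (mul_le_mul hmN (hw m hm) h0 (by positivity))

lemma sum_range_sq_le {w : ℕ → ℝ} {N m : ℕ} {V : ℝ} (hw : ∀ i < m, w i ^ 2 ≤ V) (hV : 0 ≤ V)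
    (hm : m ≤ N) : ∑ i ∈ Finset.range m, w i ^ 2 ≤ N * V := by
  calc ∑ i ∈ Finset.range m, w i ^ 2 ≤ ∑ _i ∈ Finset.range m, V :=
        Finset.sum_le_sum fun i hi => hw i (Finset.mem_range.1 hi)
    _ = m * V := by simp
    _ ≤ N * V := mul_le_mul_of_nonneg_right (by exact_mod_cast hm) hV

/-- A discrete second-order Poincaré inequality, in dual form: a sequence with vanishing zeroth and
first moments is controlled by second differences of the test sequence. -/
lemma sq_sum_mul_le_second_diff (w g : ℕ → ℝ) (M : ℕ)
    (h0 : ∑ i ∈ Finset.range (M + 2), w i = 0)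
    (h1 : ∑ i ∈ Finset.range (M + 2), (i : ℝ) * w i = 0) :
    (∑ i ∈ Finset.range (M + 2), w i * g i) ^ 2
      ≤ ((M + 2 : ℕ) : ℝ) ^ 4 * (∑ i ∈ Finset.range (M + 2), w i ^ 2)
        * ∑ i ∈ Finset.range M, (g i - 2 * g (i + 1) + g (i + 2)) ^ 2 := by
  set N := M + 2 with hN
  set V := ∑ i ∈ Finset.range N, w i ^ 2 with hV
  set S : ℕ → ℝ := fun m => ∑ i ∈ Finset.range m, w i with hS
  set T : ℕ → ℝ := fun m => ∑ l ∈ Finset.range m, S l with hT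
  have hV0 : 0 ≤ V := Finset.sum_nonneg fun _ _ => sq_nonneg _
  have hw : ∀ i, T (i + 2) - 2 * T (i + 1) + T i = w i := fun i => by
    simp only [hT, hS, Finset.sum_range_succ]; ring
  have hT0 : T 0 = 0 := by simp [hT]
  have hT1 : T 1 = 0 := by simp [hT, hS]
  have hTN : T N = 0 := by
    have := sum_range_sum_range w N
    rw [h0, h1] at this
    simpa [hT, hS] using this
  have hTN1 : T (N + 1) = 0 := by
    have : T (N + 1) = T N + S N := Finset.sum_range_succ _ _
    rw [this, hTN, zero_add]
    exact h0
  have hSb : ∀ m ≤ N, S m ^ 2 ≤ N * V := fun m hm =>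
    sq_sum_range_le (fun l hl => Finset.sum_le_sum_of_subset_of_nonneg
      (Finset.range_mono hl) fun _ _ _ => sq_nonneg _) hm
  have hTb : ∀ m ≤ N, T m ^ 2 ≤ N * (N * (N * V)) := fun m hm =>
    sq_sum_range_le (fun l hl => sum_range_sq_le (fun i hi => hSb i (by omega))
      (by positivity) hl) hm
  have hparts := sum_second_diff_mul T g M
  simp_rw [hw] at hparts
  rw [show T (M + 3) = 0 from hTN1, show T (M + 2) = 0 from hTN, hT0, hT1] at hparts
  simp only [zero_mul, add_zero] at hparts
  rw [hparts]
  refine (Finset.sum_mul_sq_le_sq_mul_sq _ _ _).trans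
    (mul_le_mul_of_nonneg_right ?_ (Finset.sum_nonneg fun _ _ => sq_nonneg _))
  calc ∑ i ∈ Finset.range M, T (i + 2) ^ 2
      ≤ N * (N * (N * (N * V))) :=
        sum_range_sq_le (w := fun i => T (i + 2)) (N := N) (fun i hi => hTb _ (by omega))
          (by positivity) (by omega)
    _ = (N : ℝ) ^ 4 * V := by ring

end SecondDifference

section Box

lemma sum_eSite_eq (k : ℕ) (v : Fin (2 * k + 1) → ℝ) :
    v = ∑ i : Fin (2 * k + 1), v i • eSite k ((i : ℤ) - k) := by
  ext j
  simp [eSite, Finset.sum_apply, Fin.val_inj]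

lemma map_XdirBox (k : ℕ) (L : (Fin (2 * k + 1) → ℝ) →ₗ[ℝ] ℝ) (j : ℤ) :
    L (XdirBox k j) = L (eSite k (j - 1)) - 2 * L (eSite k j) + L (eSite k (j + 1)) := by
  have : XdirBox k j = eSite k (j - 1) - (2 : ℝ) • eSite k j + eSite k (j + 1) := by
    ext i; simp [XdirBox]
  simp [this]

/-- A linear functional restricted to `W_{0,k}` is controlled by its values on the directions
`X_j`. -/
lemma sq_map_le_sum_XdirBox {k : ℕ} (hk : 1 ≤ k) (L : (Fin (2 * k + 1) → ℝ) →ₗ[ℝ] ℝ)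
    {v : Fin (2 * k + 1) → ℝ} (hv0 : ∑ i, v i = 0)
    (hv1 : ∑ i : Fin (2 * k + 1), ((i : ℝ) - k) * v i = 0) :
    L v ^ 2 ≤ (2 * (k : ℝ) + 1) ^ 4 * (∑ i, v i ^ 2)
      * ∑ j ∈ Finset.Icc (-(k : ℤ) + 1) ((k : ℤ) - 1), L (XdirBox k j) ^ 2 := by
  obtain ⟨M, hM⟩ : ∃ M, 2 * k + 1 = M + 2 := ⟨2 * k - 1, by omega⟩
  set w : ℕ → ℝ := fun i => if h : i < 2 * k + 1 then v ⟨i, h⟩ else 0 with hw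
  set g : ℕ → ℝ := fun i => L (eSite k ((i : ℤ) - k)) with hg
  have hwv : ∀ i : Fin (2 * k + 1), w i = v i := fun i => dif_pos i.2
  have hv1' : ∑ i : Fin (2 * k + 1), (i : ℝ) * v i = 0 := by
    simp_rw [sub_mul, Finset.sum_sub_distrib, ← Finset.mul_sum, hv0] at hv1
    simpa using hv1
  have hLv : L v = ∑ i ∈ Finset.range (M + 2), w i * g i := by
    rw [← hM, Finset.sum_range (fun i => w i * g i)]
    conv_lhs => rw [sum_eSite_eq k v]
    simp [hwv, hg]
  have hX : ∑ j ∈ Finset.Icc (-(k : ℤ) + 1) ((k : ℤ) - 1), L (XdirBox k j) ^ 2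
      = ∑ i ∈ Finset.range M, (g i - 2 * g (i + 1) + g (i + 2)) ^ 2 := by
    refine Finset.sum_nbij' (fun j => (j + k - 1).toNat) (fun i => (i : ℤ) + 1 - k)
      ?_ ?_ ?_ ?_ ?_
    · intro j hj; simp at hj ⊢; omega
    · intro i hi; simp at hi ⊢; omega
    · intro j hj; simp at hj ⊢; omega
    · intro i hi; simp
    · intro j hj
      simp only [Finset.mem_Icc] at hj
      have e : ((j + k - 1).toNat : ℤ) = j + k - 1 := Int.toNat_of_nonneg (by omega)
      simp only [hg, map_XdirBox]
      push_cast
      rw [e]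
      ring_nf
  have h := sq_sum_mul_le_second_diff w g M
    (by rw [← hM, Finset.sum_range w]; simpa [hwv] using hv0)
    (by rw [← hM, Finset.sum_range (fun i => (i : ℝ) * w i)]; simpa [hwv] using hv1')
  rw [← hLv, ← hX, ← hM, Finset.sum_range (fun i => w i ^ 2)] at h
  simpa [hwv] using h

lemma continuous_cfBox (k : ℕ) (j : ℤ) : Continuous fun x => cfBox k x j := by
  unfold cfBox
  split_ifs <;> fun_prop

/-- The part of `|∇f|²` along `W_{0,k}` is bounded by the integrand of the Dirichlet form. -/
lemma sq_norm_comp_le_sum_XdirBox {k : ℕ} (hk : 1 ≤ k) (L : (Fin (2 * k + 1) → ℝ) →L[ℝ] ℝ)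
    {F : Type*} [NormedAddCommGroup F] [NormedSpace ℝ F] (B : F →L[ℝ] (Fin (2 * k + 1) → ℝ))
    (hB : ∀ z, ∑ i, B z i ^ 2 = ‖z‖ ^ 2) (hB0 : ∀ z, ∑ i, B z i = 0)
    (hB1 : ∀ z, ∑ i : Fin (2 * k + 1), ((i : ℝ) - k) * B z i = 0) :
    ‖L.comp B‖ ^ 2 ≤ (2 * (k : ℝ) + 1) ^ 4
      * ∑ j ∈ Finset.Icc (-(k : ℤ) + 1) ((k : ℤ) - 1), L (XdirBox k j) ^ 2 := by
  set Q := (2 * (k : ℝ) + 1) ^ 4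
      * ∑ j ∈ Finset.Icc (-(k : ℤ) + 1) ((k : ℤ) - 1), L (XdirBox k j) ^ 2
  have hQ : 0 ≤ Q := mul_nonneg (by positivity) (Finset.sum_nonneg fun _ _ => sq_nonneg _)
  have h : ‖L.comp B‖ ≤ √Q := by
    refine ContinuousLinearMap.opNorm_le_bound _ (Real.sqrt_nonneg _) fun z => ?_
    refine abs_le_of_sq_le_sq ?_ (by positivity)
    have := sq_map_le_sum_XdirBox hk L.toLinearMap (hB0 z) (hB1 z)
    rw [hB] at this
    rw [mul_pow, Real.sq_sqrt hQ]
    refine this.trans_eq ?_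
    simp only [Q, ContinuousLinearMap.coe_coe]
    ring
  calc _ ≤ √Q ^ 2 := pow_le_pow_left₀ (norm_nonneg _) h 2
    _ = Q := Real.sq_sqrt hQ

/-- The canonical measure as an affine image of the standard Gaussian of a Euclidean space. -/
lemma IsCanonicalMeasure.exists_map_stdGaussian {k : ℕ} {y1 y2 : ℝ}
    {ν : Measure (Fin (2 * k + 1) → ℝ)} (h : IsCanonicalMeasure k y1 y2 ν) :
    ∃ (p : Fin (2 * k + 1) → ℝ)
      (B : EuclideanSpace ℝ (Fin (2 * k - 1)) →L[ℝ] (Fin (2 * k + 1) → ℝ)),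
      (∀ z, ∑ i, B z i ^ 2 = ‖z‖ ^ 2) ∧ (∀ z, ∑ i, B z i = 0) ∧
      (∀ z, ∑ i : Fin (2 * k + 1), ((i : ℝ) - k) * B z i = 0) ∧
      ν = (ProbabilityTheory.stdGaussian (EuclideanSpace ℝ (Fin (2 * k - 1)))).map
        (fun z => p + B z) := by
  obtain ⟨p, ι, -, -, hiso, hrange, rfl⟩ := h
  have hmem : ∀ z, (∑ i, ι z i) = 0 ∧ ∑ i : Fin (2 * k + 1), ((i : ℝ) - k) * ι z i = 0 :=
    fun z => by
      have : ι z ∈ Set.range ι := ⟨z, rfl⟩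
      rwa [hrange] at this
  let B : EuclideanSpace ℝ (Fin (2 * k - 1)) →L[ℝ] (Fin (2 * k + 1) → ℝ) :=
    LinearMap.toContinuousLinearMap (ι ∘ₗ (WithLp.linearEquiv 2 ℝ _).toLinearMap)
  have hB : ∀ z, B z = ι z.ofLp := fun z => rfl
  refine ⟨p, B, fun z => ?_, fun z => (hmem _).1, fun z => (hmem _).2, ?_⟩
  · rw [hB, hiso, EuclideanSpace.real_norm_sq_eq]
  · rw [← ProbabilityTheory.map_pi_eq_stdGaussian, Measure.map_map (by fun_prop) (by fun_prop)]
    rfl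

end Box

/-- **Spectral gap, uniform in the conserved quantities.**
There is a universal constant `C > 0`, independent of `k` and of `y = (y¹,y²)`, such
that for every `k ≥ 2`, every `y`, and every `C¹` bounded function `f` with bounded
first derivatives and `∫ f dν^c_{y,k} = 0`, one has
`∫ f² dν^c_{y,k} ≤ C·k⁴·D_{y,k}(f)`. -/
theorem spectral_gap_uniform
    (a : ℝ × ℝ × ℝ → ℝ) (astar : ℝ) (hastar : 1 ≤ astar)
    (ha : ContDiff ℝ 1 a) (hda : ∃ M : ℝ, ∀ p, ‖fderiv ℝ a p‖ ≤ M)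
    (hbd : ∀ p, astar⁻¹ ≤ a p ∧ a p ≤ astar) :
    ∃ C : ℝ, 0 < C ∧
      ∀ (k : ℕ), 2 ≤ k → ∀ (y1 y2 : ℝ) (ν : Measure (Fin (2 * k + 1) → ℝ)),
        IsCanonicalMeasure k y1 y2 ν →
        ∀ f : (Fin (2 * k + 1) → ℝ) → ℝ, ContDiff ℝ 1 f →
          (∃ M : ℝ, ∀ x, |f x| ≤ M ∧ ‖fderiv ℝ f x‖ ≤ M) →
          (∫ x, f x ∂ν) = 0 →
          ∫ x, (f x) ^ 2 ∂ν ≤ C * (k : ℝ) ^ 4 * dirichletForm a k ν f := by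
  have hastar0 : 0 < astar := by linarith
  refine ⟨Real.pi ^ 2 / 8 * 81 * astar * 2, by positivity, ?_⟩
  intro k hk y1 y2 ν hν f hf ⟨M, hM⟩ hf0
  obtain ⟨p, B, hB, hB0, hB1, rfl⟩ := hν.exists_map_stdGaussian
  set γ := ProbabilityTheory.stdGaussian (EuclideanSpace ℝ (Fin (2 * k - 1)))
  set s := Finset.Icc (-(k : ℤ) + 1) ((k : ℤ) - 1)
  set A := fun z : EuclideanSpace ℝ (Fin (2 * k - 1)) => p + B z
  have hAc : Continuous A := by fun_prop
  have hfd : Continuous (fderiv ℝ f) := hf.continuous_fderiv one_ne_zero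
  have hac : Continuous a := ha.continuous
  set F : (Fin (2 * k + 1) → ℝ) → ℝ := fun x => ∑ j ∈ s,
    a (cfBox k x (j - 1), cfBox k x j, cfBox k x (j + 1)) * (fderiv ℝ f x (XdirBox k j)) ^ 2 with hF
  have hcf := continuous_cfBox k
  have hFc : Continuous F := by fun_prop
  have hFi : Integrable (fun z => F (A z)) γ := by
    refine integrable_finsetSum _ fun j _ => ?_
    refine Integrable.of_bound (Continuous.aestronglyMeasurable (by fun_prop))
      (astar * (M * ‖XdirBox k j‖) ^ 2) (ae_of_all _ fun z => ?_)
    rw [norm_mul, norm_pow]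
    refine mul_le_mul ?_ (pow_le_pow_left₀ (norm_nonneg _) (ContinuousLinearMap.le_of_opNorm_le _
      (hM _).2 _) 2) (by positivity) hastar0.le
    rw [Real.norm_of_nonneg ((inv_pos.2 hastar0).le.trans (hbd _).1)]
    exact (hbd _).2
  have hgc : ContDiff ℝ 1 fun z => f (A z) :=
    hf.comp (contDiff_const.add B.contDiff)
  have hder : ∀ z, fderiv ℝ (fun z => f (A z)) z = (fderiv ℝ f (A z)).comp B := fun z =>
    ((hf.differentiable one_ne_zero (A z)).hasFDerivAt.comp z
      (B.hasFDerivAt.const_add p)).fderiv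
  have hpt : ∀ z, ‖fderiv ℝ (fun z => f (A z)) z‖ ^ 2
      ≤ 81 * (k : ℝ) ^ 4 * astar * F (A z) := by
    intro z
    rw [hder]
    refine (sq_norm_comp_le_sum_XdirBox (by omega) _ B hB hB0 hB1).trans ?_
    have hk1 : (2 * (k : ℝ) + 1) ^ 4 ≤ 81 * (k : ℝ) ^ 4 := by
      have : (2 : ℝ) ≤ k := by exact_mod_cast hk
      calc (2 * (k : ℝ) + 1) ^ 4 ≤ (3 * k) ^ 4 := by gcongr; linarith
        _ = 81 * (k : ℝ) ^ 4 := by ring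
    rw [mul_assoc (81 * (k : ℝ) ^ 4)]
    refine mul_le_mul hk1 ?_ (Finset.sum_nonneg fun _ _ => sq_nonneg _) (by positivity)
    rw [hF, Finset.mul_sum]
    refine Finset.sum_le_sum fun j _ => ?_
    rw [← mul_assoc]
    refine le_mul_of_one_le_left (sq_nonneg _) ?_
    rw [← inv_le_iff_one_le_mul₀' hastar0]
    exact (hbd _).1
  have hpoin := integral_sq_le_integral_sq_norm_fderiv_stdGaussian hgc
    (M := max M (M * ‖B‖)) (fun z => (hM _).1.trans (le_max_left _ _))
    (fun z => by
      rw [hder]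
      exact ((ContinuousLinearMap.opNorm_comp_le _ _).trans (mul_le_mul_of_nonneg_right (hM _).2
        (norm_nonneg _))).trans (le_max_right _ _))
    (by rwa [integral_map hAc.aemeasurable hf.continuous.aestronglyMeasurable] at hf0)
  rw [dirichletForm, integral_map hAc.aemeasurable hFc.aestronglyMeasurable,
    integral_map (f := fun x => f x ^ 2) hAc.aemeasurable
      (hf.continuous.pow 2).aestronglyMeasurable]
  calc ∫ z, f (A z) ^ 2 ∂γ
      ≤ Real.pi ^ 2 / 8 * ∫ z, ‖fderiv ℝ (fun z => f (A z)) z‖ ^ 2 ∂γ := hpoin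
    _ ≤ Real.pi ^ 2 / 8 * ∫ z, 81 * (k : ℝ) ^ 4 * astar * F (A z) ∂γ := by
        refine mul_le_mul_of_nonneg_left ?_ (by positivity)
        exact integral_mono_of_nonneg (ae_of_all _ fun _ => sq_nonneg _) (hFi.const_mul _)
          (ae_of_all _ hpt)
    _ = _ := by
        rw [integral_const_mul]
        ring
end

section
/- (Uniform bounds on the central limit theorem variance.) Let h : ℝ^{2s+1} → ℝ be a bounded C¹ function with bounded first derivatives, and for j ∈ ℤ define the shifted local function f_j(x) = a_j(x)·(x_{j−1} − 2x_j + x_{j+1})·h(x_{j−s},…,x_{j+s}) − X_j(a_j(x)·h(x_{j−s},…,x_{j+s})). For k with k − √k ≥ s + 1 and y ∈ ℝ², set F_k = Σ_{|j| ≤ k−√k} f_j and define the variance 𝕍_k(y) = sup_u (∫ F_k·u dν^c_{y,k})² / (k·D_{y,k}(u)), the supremum being over C¹ bounded functions u with bounded first derivatives such that D_{y,k}(u) > 0. Then: (i) there is a constant C(h) < ∞, depending only on h and a, such that 𝕍_k(y) ≤ C(h) for all such k and all y ∈ ℝ²; (ii) if in addition h ≥ c for some constant c > 0, there is a constant C₁(h)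 > 0 such that 𝕍_k(y) ≥ C₁(h) for all such k and all y ∈ ℝ². -/
open MeasureTheory

/-- `a_j(x) = a(x_{j−1}, x_j, x_{j+1})` at lattice site `j` of the box. -/
noncomputable def aAt (a : ℝ × ℝ × ℝ → ℝ) (k : ℕ) (j : ℤ) (x : Fin (2 * k + 1) → ℝ) : ℝ :=
  a (cfBox k x (j - 1), cfBox k x j, cfBox k x (j + 1))

/-- The discrete Laplacian `x_{j−1} − 2x_j + x_{j+1}` at site `j`. -/
noncomputable def lapAt (k : ℕ) (j : ℤ) (x : Fin (2 * k + 1) → ℝ) : ℝ :=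
  cfBox k x (j - 1) - 2 * cfBox k x j + cfBox k x (j + 1)

/-- The shifted local function `h(x_{j−s},…,x_{j+s})`. -/
noncomputable def hWin (s : ℕ) (h : (Fin (2 * s + 1) → ℝ) → ℝ) (k : ℕ) (j : ℤ)
    (x : Fin (2 * k + 1) → ℝ) : ℝ :=
  h (fun i => cfBox k x (j + (i : ℤ) - s))

/-- The shifted local function
`f_j(x) = a_j(x)·(x_{j−1}−2x_j+x_{j+1})·h(x_{j−s},…,x_{j+s}) − X_j(a_j·h(x_{j−s},…,x_{j+s}))(x)`. -/
noncomputable def fShift (a : ℝ × ℝ × ℝ → ℝ) (s : ℕ) (h : (Fin (2 * s + 1) → ℝ) → ℝ)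
    (k : ℕ) (j : ℤ) (x : Fin (2 * k + 1) → ℝ) : ℝ :=
  aAt a k j x * lapAt k j x * hWin s h k j x
    - fderiv ℝ (fun y => aAt a k j y * hWin s h k j y) x (XdirBox k j)

/-- `F_k = Σ_{|j| ≤ k−√k} f_j`. -/
noncomputable def Fsum (a : ℝ × ℝ × ℝ → ℝ) (s : ℕ) (h : (Fin (2 * s + 1) → ℝ) → ℝ)
    (k : ℕ) (x : Fin (2 * k + 1) → ℝ) : ℝ :=
  ∑ j ∈ Finset.Icc (-(⌊(k : ℝ) - Real.sqrt k⌋)) ⌊(k : ℝ) - Real.sqrt k⌋,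
    fShift a s h k j x

/-- An admissible test function for the variational formula of the variance:
`C¹`, bounded, with bounded first derivatives. -/
def AdmissibleU (k : ℕ) (u : (Fin (2 * k + 1) → ℝ) → ℝ) : Prop :=
  ContDiff ℝ 1 u ∧ ∃ M : ℝ, ∀ x, |u x| ≤ M ∧ ‖fderiv ℝ u x‖ ≤ M

/-- The set of Rayleigh-type ratios whose supremum is the central limit theorem
variance `𝕍_k(y) = sup_u (∫ F_k·u dν^c_{y,k})² / (k·D_{y,k}(u))`. -/
noncomputable def VarSet (a : ℝ × ℝ × ℝ → ℝ) (s : ℕ) (h : (Fin (2 * s + 1) → ℝ) → ℝ)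
    (k : ℕ) (ν : Measure (Fin (2 * k + 1) → ℝ)) : Set ℝ :=
  {r : ℝ | ∃ u : (Fin (2 * k + 1) → ℝ) → ℝ, AdmissibleU k u ∧
    0 < dirichletForm a k ν u ∧
    r = (∫ x, Fsum a s h k x * u x ∂ν) ^ 2 / ((k : ℝ) * dirichletForm a k ν u)}

/-- A `C¹` function which is bounded together with its first derivative. -/
def Bdd1 {E : Type*} [NormedAddCommGroup E] [NormedSpace ℝ E] (f : E → ℝ) : Prop :=
  ContDiff ℝ 1 f ∧ ∃ M : ℝ, ∀ x, |f x| ≤ M ∧ ‖fderiv ℝ f x‖ ≤ M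

section Bdd1

variable {E F : Type*} [NormedAddCommGroup E] [NormedSpace ℝ E]
  [NormedAddCommGroup F] [NormedSpace ℝ F]

theorem Bdd1.hasFDerivAt {f : E → ℝ} (hf : Bdd1 f) (x : E) :
    HasFDerivAt f (fderiv ℝ f x) x :=
  (hf.1.differentiable one_ne_zero x).hasFDerivAt

theorem Bdd1.continuous_fderiv_apply {f : E → ℝ} (hf : Bdd1 f) (v : E) :
    Continuous fun x => fderiv ℝ f x v :=
  (hf.1.continuous_fderiv one_ne_zero).clm_apply continuous_const

theorem Bdd1.exists_abs_fderiv_apply_le {f : E → ℝ} (hf : Bdd1 f) (v : E) :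
    ∃ M : ℝ, ∀ x, |fderiv ℝ f x v| ≤ M := by
  obtain ⟨M, hM⟩ := hf.2
  refine ⟨M * ‖v‖, fun x => ?_⟩
  exact ((fderiv ℝ f x).le_opNorm v).trans
    (mul_le_mul_of_nonneg_right (hM x).2 (norm_nonneg v))

theorem fderiv_comp_const_add {f : E → ℝ} (hf : Differentiable ℝ f) (A : F →L[ℝ] E) (b : E)
    (x : F) : fderiv ℝ (fun z => f (b + A z)) x = (fderiv ℝ f (b + A x)).comp A :=
  ((hf (b + A x)).hasFDerivAt.comp x (A.hasFDerivAt.const_add b)).fderiv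

theorem Bdd1.comp_affine {f : E → ℝ} (hf : Bdd1 f) (A : F →L[ℝ] E) (b : E) :
    Bdd1 fun z => f (b + A z) := by
  obtain ⟨M, hM⟩ := hf.2
  have hM0 : 0 ≤ M := (abs_nonneg _).trans (hM 0).1
  refine ⟨hf.1.comp (contDiff_const.add A.contDiff), max M (M * ‖A‖), fun x => ⟨?_, ?_⟩⟩
  · exact (hM _).1.trans (le_max_left _ _)
  · rw [fderiv_comp_const_add (hf.1.differentiable one_ne_zero)]
    refine le_trans ?_ (le_max_right _ _)
    exact (ContinuousLinearMap.opNorm_comp_le _ _).trans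
      (mul_le_mul_of_nonneg_right (hM _).2 (norm_nonneg A))

theorem Bdd1.comp_clm {f : E → ℝ} (hf : Bdd1 f) (A : F →L[ℝ] E) : Bdd1 fun z => f (A z) := by
  simpa using hf.comp_affine A 0

theorem Bdd1.mul {f g : E → ℝ} (hf : Bdd1 f) (hg : Bdd1 g) : Bdd1 fun x => f x * g x := by
  obtain ⟨M, hM⟩ := hf.2
  obtain ⟨N, hN⟩ := hg.2
  refine ⟨hf.1.mul hg.1, max (M * N) (M * N + N * M), fun x => ⟨?_, ?_⟩⟩
  · refine le_trans ?_ (le_max_left _ _)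
    rw [abs_mul]
    exact mul_le_mul (hM x).1 (hN x).1 (abs_nonneg _) ((abs_nonneg _).trans (hM x).1)
  · refine le_trans ?_ (le_max_right _ _)
    rw [((hf.hasFDerivAt x).fun_mul (hg.hasFDerivAt x)).fderiv]
    refine (norm_add_le _ _).trans (add_le_add ?_ ?_)
    · rw [norm_smul]
      exact mul_le_mul (hM x).1 (hN x).2 (norm_nonneg _) ((abs_nonneg _).trans (hM x).1)
    · rw [norm_smul]
      exact mul_le_mul (hN x).1 (hM x).2 (norm_nonneg _) ((abs_nonneg _).trans (hN x).1)

end Bdd1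

theorem integrable_of_continuous_of_abs_le {E : Type*} [NormedAddCommGroup E]
    [MeasurableSpace E] [BorelSpace E] [SecondCountableTopology E] {μ : Measure E} [IsFiniteMeasure μ] {f : E → ℝ}
    (hf : Continuous f) {M : ℝ} (hM : ∀ x, |f x| ≤ M) : Integrable f μ :=
  Integrable.of_bound hf.aestronglyMeasurable M (Filter.Eventually.of_forall hM)

theorem MeasureTheory.Integrable.mul_continuous_bounded {E : Type*}
    [NormedAddCommGroup E]
    [MeasurableSpace E] [BorelSpace E] [SecondCountableTopology E] {μ : Measure E} {l f : E → ℝ} (hl : Integrable l μ)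
    (hf : Continuous f) {M : ℝ} (hM : ∀ x, |f x| ≤ M) : Integrable (fun x => l x * f x) μ :=
  hl.mul_bdd hf.aestronglyMeasurable (Filter.Eventually.of_forall hM)

section Stein

open ProbabilityTheory

theorem hasDerivAt_gaussianPDFReal_zero_one (x : ℝ) :
    HasDerivAt (gaussianPDFReal 0 1) (-x * gaussianPDFReal 0 1 x) x := by
  rw [gaussianPDFReal_def]
  have h1 : HasDerivAt (fun y : ℝ => -(y - 0) ^ 2 / (2 * ((1 : NNReal) : ℝ))) (-x) x := by
    have := ((((hasDerivAt_id x).sub_const 0).pow 2).neg).div_const (2 * ((1 : NNReal) : ℝ))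
    refine this.congr_deriv ?_
    simp
    ring
  refine (h1.exp.const_mul _).congr_deriv ?_
  ring

theorem stein_gaussianReal {g g' : ℝ → ℝ} (hg : ∀ x, HasDerivAt g (g' x) x)
    (hg' : Continuous g') {M : ℝ} (hM : ∀ x, |g x| ≤ M) (hM' : ∀ x, |g' x| ≤ M) :
    ∫ x, g' x ∂(gaussianReal 0 1) = ∫ x, x * g x ∂(gaussianReal 0 1) := by
  have hgc : Continuous g := continuous_iff_continuousAt.2 fun x => (hg x).continuousAt
  have hid : Integrable (fun x : ℝ => x) (gaussianReal 0 1) :=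
    (memLp_id_gaussianReal' 1 (by simp)).integrable le_rfl
  have key : ∀ f : ℝ → ℝ, Integrable f (gaussianReal 0 1) →
      Integrable (fun x => gaussianPDFReal 0 1 x * f x) := by
    intro f hf
    rw [gaussianReal_of_var_ne_zero 0 one_ne_zero,
      integrable_withDensity_iff_integrable_smul' (by fun_prop) (by simp [gaussianPDF])] at hf
    refine hf.congr (Filter.Eventually.of_forall fun x => ?_)
    simp [gaussianPDF, ENNReal.toReal_ofReal (gaussianPDFReal_nonneg 0 1 x)]
  have i1 := key _ (integrable_of_continuous_of_abs_le hgc hM)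
  have i2 := key _ (integrable_of_continuous_of_abs_le hg' hM')
  have i3 := key _ (hid.mul_continuous_bounded hgc hM)
  rw [integral_gaussianReal_eq_integral_smul one_ne_zero,
    integral_gaussianReal_eq_integral_smul one_ne_zero]
  simp only [smul_eq_mul]
  have := integral_mul_deriv_eq_deriv_mul_of_integrable (u := gaussianPDFReal 0 1) (v := g)
    (fun x _ => hasDerivAt_gaussianPDFReal_zero_one x) (fun x _ => hg x) i2
    (i3.neg.congr (Filter.Eventually.of_forall fun x => by simp; ring)) i1
  rw [this, ← integral_neg]
  exact integral_congr_ae (Filter.Eventually.of_forall fun x => by simp; ring)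

/-- The standard Gaussian measure on `ℝⁿ`. -/
noncomputable abbrev stdGauss (n : ℕ) : Measure (Fin n → ℝ) :=
  Measure.pi fun _ : Fin n => gaussianReal 0 1

theorem integrable_eval_stdGauss {n : ℕ} (i : Fin n) :
    Integrable (fun z : Fin n → ℝ => z i) (stdGauss n) := by
  have hid : Integrable (fun x : ℝ => x) (gaussianReal 0 1) :=
    (memLp_id_gaussianReal' 1 (by simp)).integrable le_rfl
  exact (measurePreserving_eval (fun _ : Fin n => gaussianReal 0 1) i).integrable_comp_of_integrable
    hid

theorem stein_stdGauss_single {n : ℕ} (i : Fin n) {φ : (Fin n → ℝ) → ℝ} (hφ : Bdd1 φ) :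
    ∫ z, fderiv ℝ φ z (Pi.single i 1) ∂(stdGauss n) = ∫ z, z i * φ z ∂(stdGauss n) := by
  cases n with
  | zero => exact i.elim0
  | succ n =>
    obtain ⟨M, hM⟩ := hφ.2
    obtain ⟨N, hN⟩ := hφ.exists_abs_fderiv_apply_le (Pi.single i 1)
    have mp := (measurePreserving_piFinSuccAbove
      (fun _ : Fin (n + 1) => gaussianReal 0 1) i).symm
    have i1 : Integrable (fun z => fderiv ℝ φ z (Pi.single i 1)) (stdGauss (n + 1)) :=
      integrable_of_continuous_of_abs_le (hφ.continuous_fderiv_apply _) hN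
    have i2 : Integrable (fun z => z i * φ z) (stdGauss (n + 1)) :=
      (integrable_eval_stdGauss i).mul_continuous_bounded hφ.1.continuous fun x => (hM x).1
    have j1 := mp.integrable_comp_of_integrable i1
    have j2 := mp.integrable_comp_of_integrable i2
    simp only [Function.comp_def] at j1 j2
    rw [← mp.integral_comp', ← mp.integral_comp', integral_prod_symm _ j1,
      integral_prod_symm _ j2]
    refine integral_congr_ae (Filter.Eventually.of_forall fun w => ?_)
    have hins : ∀ x : ℝ, (MeasurableEquiv.piFinSuccAbove (fun _ : Fin (n + 1) => ℝ) i).symm (x, w)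
        = i.insertNth 0 w + x • Pi.single i 1 := by
      intro x
      rw [MeasurableEquiv.piFinSuccAbove_symm_apply]
      ext j
      refine Fin.succAboveCases i ?_ (fun l => ?_) j <;> simp [Fin.insertNthEquiv]
    simp only [hins]
    have hd : ∀ x : ℝ, HasDerivAt (fun x : ℝ => φ (i.insertNth 0 w + x • Pi.single i 1))
        (fderiv ℝ φ (i.insertNth 0 w + x • Pi.single i 1) (Pi.single i 1)) x := by
      intro x
      refine (hφ.hasFDerivAt _).comp_hasDerivAt x ?_
      simpa using ((hasDerivAt_id x).smul_const (Pi.single i (1 : ℝ))).const_add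
        (i.insertNth (α := fun _ => ℝ) 0 w)
    have hc : Continuous fun x : ℝ =>
        i.insertNth (α := fun _ => ℝ) 0 w + x • Pi.single i (1 : ℝ) := by
      fun_prop
    have := stein_gaussianReal hd ((hφ.continuous_fderiv_apply _).comp hc)
      (M := max M N) (fun x => (hM _).1.trans (le_max_left _ _))
      (fun x => (hN _).trans (le_max_right _ _))
    rw [this]
    simp

theorem stein_stdGauss {n : ℕ} {φ : (Fin n → ℝ) → ℝ} (hφ : Bdd1 φ) (v : Fin n → ℝ) :
    ∫ z, fderiv ℝ φ z v ∂(stdGauss n) = ∫ z, (∑ i, v i * z i) * φ z ∂(stdGauss n) := by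
  obtain ⟨M, hM⟩ := hφ.2
  have hv : ∀ z, fderiv ℝ φ z v = ∑ i, v i * fderiv ℝ φ z (Pi.single i 1) := by
    intro z
    conv_lhs => rw [← Finset.univ_sum_single v]
    rw [map_sum]
    refine Finset.sum_congr rfl fun i _ => ?_
    rw [← smul_eq_mul, ← map_smul, ← Pi.single_smul, smul_eq_mul, mul_one]
  simp only [hv, Finset.sum_mul, mul_assoc]
  rw [integral_finsetSum, integral_finsetSum]
  · simp only [integral_const_mul, stein_stdGauss_single _ hφ]
  · exact fun i _ => ((integrable_eval_stdGauss i).mul_continuous_bounded hφ.1.continuous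
      fun x => (hM x).1).const_mul _
  · intro i _
    obtain ⟨N, hN⟩ := hφ.exists_abs_fderiv_apply_le (Pi.single i 1)
    exact (integrable_of_continuous_of_abs_le (hφ.continuous_fderiv_apply _) hN).const_mul _

end Stein

section Box

theorem eSite_eq_zero {k : ℕ} {j : ℤ} (hj : ¬(0 ≤ j + k ∧ j + k < 2 * k + 1))
    (i : Fin (2 * k + 1)) : eSite k j i = 0 := by
  unfold eSite
  rw [if_neg]
  have := i.2
  omega

theorem cfBox_eq_sum (k : ℕ) (x : Fin (2 * k + 1) → ℝ) (j : ℤ) :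
    cfBox k x j = ∑ i, eSite k j i * x i := by
  unfold cfBox
  split_ifs with h
  · rw [Finset.sum_eq_single ⟨(j + k).toNat, h.1⟩]
    · simp [eSite, Int.toNat_of_nonneg h.2]
    · intro b _ hb
      have : ((b : ℕ) : ℤ) ≠ j + k := fun hbj => hb (Fin.ext (by simp [← hbj]))
      simp [eSite, this]
    · simp
  · rw [Finset.sum_eq_zero]
    intro i _
    rw [eSite_eq_zero (by omega), zero_mul]

/-- The coordinate at site `j` as a continuous linear functional on the box. -/
noncomputable def cfCLM (k : ℕ) (j : ℤ) : (Fin (2 * k + 1) → ℝ) →L[ℝ] ℝ :=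
  ∑ i, eSite k j i • ContinuousLinearMap.proj i

theorem cfCLM_apply (k : ℕ) (j : ℤ) (x : Fin (2 * k + 1) → ℝ) : cfCLM k j x = cfBox k x j := by
  simp [cfCLM, cfBox_eq_sum]

theorem sum_XdirBox_mul (k : ℕ) (j : ℤ) (x : Fin (2 * k + 1) → ℝ) :
    ∑ i, XdirBox k j i * x i = lapAt k j x := by
  simp only [lapAt, cfBox_eq_sum, XdirBox, Finset.mul_sum, ← Finset.sum_sub_distrib,
    ← Finset.sum_add_distrib]
  exact Finset.sum_congr rfl fun i _ => by ring

theorem cfBox_of_formula {k : ℕ} (f : ℤ → ℝ) {j : ℤ} (h1 : -(k : ℤ) ≤ j) (h2 : j ≤ k) :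
    cfBox k (fun i => f ((i : ℕ) - k)) j = f j := by
  unfold cfBox
  rw [dif_pos (by omega)]
  exact congrArg f (by push_cast; omega)

theorem lapAt_of_formula {k : ℕ} (f : ℤ → ℝ) {j : ℤ} (h1 : -(k : ℤ) + 1 ≤ j)
    (h2 : j ≤ (k : ℤ) - 1) :
    lapAt k j (fun i => f ((i : ℕ) - k)) = f (j - 1) - 2 * f j + f (j + 1) := by
  unfold lapAt
  rw [cfBox_of_formula f (by omega) (by omega), cfBox_of_formula f (by omega) (by omega),
    cfBox_of_formula f (by omega) (by omega)]

/-- The direction space `W_{0,k}` of the affine subspaces `W_{y,k}`. -/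
def Wdir (k : ℕ) : Set (Fin (2 * k + 1) → ℝ) :=
  {v | (∑ i, v i) = 0 ∧ (∑ i : Fin (2 * k + 1), ((i : ℝ) - (k : ℝ)) * v i) = 0}

theorem XdirBox_mem_Wdir {k : ℕ} {j : ℤ} (h1 : -(k : ℤ) + 1 ≤ j) (h2 : j ≤ (k : ℤ) - 1) :
    XdirBox k j ∈ Wdir k := by
  constructor
  · have := sum_XdirBox_mul k j (fun _ => 1)
    rw [lapAt_of_formula (fun _ => 1) h1 h2] at this
    norm_num at this
    exact this
  · have := sum_XdirBox_mul k j (fun i => (((i : ℕ) - k : ℤ) : ℝ))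
    rw [lapAt_of_formula (fun l => (l : ℝ)) h1 h2] at this
    push_cast at this
    simp only [mul_comm _ (XdirBox k j _)]
    rw [this]
    ring

theorem Bdd1.aAt {a : ℝ × ℝ × ℝ → ℝ} (ha : Bdd1 a) (k : ℕ) (j : ℤ) : Bdd1 (aAt a k j) := by
  have := ha.comp_clm ((cfCLM k (j - 1)).prod ((cfCLM k j).prod (cfCLM k (j + 1))))
  simp only [ContinuousLinearMap.prod_apply, cfCLM_apply] at this
  exact this

theorem Bdd1.hWin {s : ℕ} {h : (Fin (2 * s + 1) → ℝ) → ℝ} (hh : Bdd1 h) (k : ℕ) (j : ℤ) :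
    Bdd1 (hWin s h k j) := by
  have := hh.comp_clm (ContinuousLinearMap.pi fun i : Fin (2 * s + 1) => cfCLM k (j + (i : ℤ) - s))
  refine (congrArg Bdd1 (funext fun x => ?_)).mp this
  exact congrArg h (funext fun i => cfCLM_apply _ _ _)

end Box

section Canonical

variable {k : ℕ} {y1 y2 : ℝ} {ν : Measure (Fin (2 * k + 1) → ℝ)}

theorem sum_mul_eq_zero_of_minimal {p v : Fin (2 * k + 1) → ℝ} (hp : p ∈ Wbox k y1 y2)
    (hmin : ∀ q ∈ Wbox k y1 y2, (∑ i, (p i) ^ 2) ≤ ∑ i, (q i) ^ 2) (hv : v ∈ Wdir k) :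
    ∑ i, v i * p i = 0 := by
  have key : ∀ t : ℝ, 0 ≤ 2 * t * (∑ i, v i * p i) + t ^ 2 * ∑ i, v i ^ 2 := by
    intro t
    have hq : (fun i => p i + t * v i) ∈ Wbox k y1 y2 := by
      constructor
      · rw [Finset.sum_add_distrib, ← Finset.mul_sum, hp.1, hv.1]; ring
      · have : ∀ i : Fin (2 * k + 1), ((i : ℝ) - (k : ℝ)) * (p i + t * v i)
            = ((i : ℝ) - k) * p i + t * (((i : ℝ) - k) * v i) := fun i => by ring
        simp only [this]
        rw [Finset.sum_add_distrib, ← Finset.mul_sum, hp.2, hv.2]; ring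
    have h := hmin _ hq
    have e : ∑ i, (p i + t * v i) ^ 2
        = ∑ i, p i ^ 2 + (2 * t * (∑ i, v i * p i) + t ^ 2 * ∑ i, v i ^ 2) := by
      rw [Finset.mul_sum, Finset.mul_sum, ← Finset.sum_add_distrib, ← Finset.sum_add_distrib]
      exact Finset.sum_congr rfl fun i _ => by ring
    linarith
  set b := ∑ i, v i * p i
  have hc : 0 ≤ ∑ i, v i ^ 2 := Finset.sum_nonneg fun i _ => sq_nonneg _
  set c := ∑ i, v i ^ 2
  have h := key (-b / (c + 1))
  have e : 2 * (-b / (c + 1)) * b + (-b / (c + 1)) ^ 2 * c = -(b ^ 2 * (c + 2)) / (c + 1) ^ 2 := by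
    field_simp
    ring
  rw [e, le_div_iff₀ (by positivity)] at h
  have : b ^ 2 = 0 := by nlinarith [sq_nonneg b]
  exact pow_eq_zero_iff two_ne_zero |>.mp this

theorem sum_mul_eq_of_isometry {m n : ℕ} {ι : (Fin m → ℝ) →ₗ[ℝ] (Fin n → ℝ)}
    (hι : ∀ z, (∑ i, (ι z i) ^ 2) = ∑ i, (z i) ^ 2) (z w : Fin m → ℝ) :
    ∑ i, ι z i * ι w i = ∑ i, z i * w i := by
  have h := hι (z + w)
  simp only [map_add, Pi.add_apply, add_sq, Finset.sum_add_distrib, hι, mul_assoc,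
    ← Finset.mul_sum] at h
  linarith

theorem IsCanonicalMeasure.isProbabilityMeasure (hν : IsCanonicalMeasure k y1 y2 ν) :
    IsProbabilityMeasure ν := by
  obtain ⟨p, ι, -, -, -, -, rfl⟩ := hν
  have : Continuous ι := LinearMap.continuous_of_finiteDimensional ι
  exact Measure.isProbabilityMeasure_map (by fun_prop)

theorem IsCanonicalMeasure.integrable_eval (hν : IsCanonicalMeasure k y1 y2 ν)
    (i : Fin (2 * k + 1)) : Integrable (fun x => x i) ν := by
  obtain ⟨p, ι, -, -, -, -, rfl⟩ := hν
  have hc : Continuous ι := LinearMap.continuous_of_finiteDimensional ι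
  rw [integrable_map_measure 
    (Continuous.aestronglyMeasurable (f := fun x : Fin (2 * k + 1) → ℝ => x i) (by fun_prop))
    (by fun_prop)]
  have : ((fun x : Fin (2 * k + 1) → ℝ => x i) ∘ fun z => p + ι z)
      = fun z => p i + ∑ l, z l * ι (Pi.single l 1) i := by
    funext z
    simp only [Function.comp_apply, Pi.add_apply]
    conv_lhs => rw [← Finset.univ_sum_single z]
    rw [map_sum, Finset.sum_apply]
    refine congrArg _ (Finset.sum_congr rfl fun l _ => ?_)
    have hl : (Pi.single l (z l) : Fin (2 * k - 1) → ℝ) = z l • Pi.single l 1 := by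
      rw [← Pi.single_smul, smul_eq_mul, mul_one]
    rw [hl, map_smul, Pi.smul_apply, smul_eq_mul]
  rw [this]
  exact (integrable_const _).add
    (integrable_finsetSum _ fun l _ => (integrable_eval_stdGauss l).mul_const _)

theorem IsCanonicalMeasure.stein (hν : IsCanonicalMeasure k y1 y2 ν)
    {φ : (Fin (2 * k + 1) → ℝ) → ℝ} (hφ : Bdd1 φ) {d : Fin (2 * k + 1) → ℝ} (hd : d ∈ Wdir k) :
    ∫ x, fderiv ℝ φ x d ∂ν = ∫ x, (∑ i, d i * x i) * φ x ∂ν := by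
  obtain ⟨p, ι, hp, hmin, hι, hrange, rfl⟩ := hν
  have hc : Continuous ι := LinearMap.continuous_of_finiteDimensional ι
  have hφc := hφ.1.continuous
  have hφd := hφ.continuous_fderiv_apply d
  rw [integral_map (by fun_prop) hφd.aestronglyMeasurable,
    integral_map (by fun_prop) (Continuous.aestronglyMeasurable (by fun_prop))]
  obtain ⟨v, rfl⟩ : d ∈ Set.range ι := by rw [hrange]; exact hd
  have h := stein_stdGauss (hφ.comp_affine (LinearMap.toContinuousLinearMap ι) p) v
  have e : ∀ z, fderiv ℝ (fun z => φ (p + LinearMap.toContinuousLinearMap ι z)) z v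
      = fderiv ℝ φ (p + ι z) (ι v) := fun z => by
    rw [fderiv_comp_const_add (hφ.1.differentiable one_ne_zero)]
    rfl
  simp only [e] at h
  simp only [LinearMap.coe_toContinuousLinearMap'] at h
  refine h.trans ?_
  refine integral_congr_ae (Filter.Eventually.of_forall fun z => ?_)
  simp only [Pi.add_apply, mul_add, Finset.sum_add_distrib,
    sum_mul_eq_zero_of_minimal hp hmin hd, sum_mul_eq_of_isometry hι, zero_add]

theorem IsCanonicalMeasure.integrable_lapAt (hν : IsCanonicalMeasure k y1 y2 ν) (j : ℤ) :
    Integrable (lapAt k j) ν := by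
  have : lapAt k j = fun x => ∑ i, XdirBox k j i * x i :=
    funext fun x => (sum_XdirBox_mul k j x).symm
  rw [this]
  exact integrable_finsetSum _ fun i _ => (hν.integrable_eval i).const_mul _

variable {a : ℝ × ℝ × ℝ → ℝ} {s : ℕ} {h : (Fin (2 * s + 1) → ℝ) → ℝ}
  {u : (Fin (2 * k + 1) → ℝ) → ℝ}

theorem integrable_mul_fderiv [IsFiniteMeasure ν] {g : (Fin (2 * k + 1) → ℝ) → ℝ} (hg : Bdd1 g)
    (hu : Bdd1 u) (d : Fin (2 * k + 1) → ℝ) : Integrable (fun x => g x * fderiv ℝ u x d) ν := by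
  obtain ⟨M, hM⟩ := hg.2
  obtain ⟨N, hN⟩ := hu.exists_abs_fderiv_apply_le d
  exact (integrable_of_continuous_of_abs_le hg.1.continuous
    fun x => (hM x).1).mul_continuous_bounded (hu.continuous_fderiv_apply d) hN

theorem IsCanonicalMeasure.fShift_ibp (hν : IsCanonicalMeasure k y1 y2 ν)
    (ha : Bdd1 a) (hh : Bdd1 h) (hu : Bdd1 u) {j : ℤ} (h1 : -(k : ℤ) + 1 ≤ j)
    (h2 : j ≤ (k : ℤ) - 1) :
    Integrable (fun x => fShift a s h k j x * u x) ν ∧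
      ∫ x, fShift a s h k j x * u x ∂ν
        = ∫ x, (aAt a k j x * hWin s h k j x) * fderiv ℝ u x (XdirBox k j) ∂ν := by
  have := hν.isProbabilityMeasure
  have hg := (ha.aAt k j).mul (hh.hWin k j)
  have hgu := hg.mul hu
  obtain ⟨M, hM⟩ := hgu.2
  have hst := hν.stein hgu (XdirBox_mem_Wdir h1 h2)
  have i1 := (hν.integrable_lapAt j).mul_continuous_bounded hgu.1.continuous fun x => (hM x).1
  have i2 := integrable_mul_fderiv (ν := ν) hu hg (XdirBox k j)
  have i3 := integrable_mul_fderiv (ν := ν) hg hu (XdirBox k j)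
  have e : (fun x => fShift a s h k j x * u x) = fun x =>
      lapAt k j x * (aAt a k j x * hWin s h k j x * u x)
        - u x * fderiv ℝ (fun y => aAt a k j y * hWin s h k j y) x (XdirBox k j) := by
    funext x
    unfold fShift
    ring
  have e2 : ∀ x, fderiv ℝ (fun x => aAt a k j x * hWin s h k j x * u x) x (XdirBox k j)
      = (aAt a k j x * hWin s h k j x) * fderiv ℝ u x (XdirBox k j)
        + u x * fderiv ℝ (fun y => aAt a k j y * hWin s h k j y) x (XdirBox k j) := by
    intro x
    rw [((hg.hasFDerivAt x).fun_mul (hu.hasFDerivAt x)).fderiv]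
    rfl
  simp only [sum_XdirBox_mul, e2] at hst
  rw [integral_add i3 i2] at hst
  rw [e]
  refine ⟨i1.sub i2, ?_⟩
  rw [integral_sub i1 i2]
  linarith

theorem IsCanonicalMeasure.integral_Fsum_mul (hν : IsCanonicalMeasure k y1 y2 ν)
    (ha : Bdd1 a) (hh : Bdd1 h) (hu : Bdd1 u) (hk : ⌊(k : ℝ) - Real.sqrt k⌋ ≤ (k : ℤ) - 1) :
    ∫ x, Fsum a s h k x * u x ∂ν
      = ∫ x, ∑ j ∈ Finset.Icc (-(⌊(k : ℝ) - Real.sqrt k⌋)) ⌊(k : ℝ) - Real.sqrt k⌋,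
          (aAt a k j x * hWin s h k j x) * fderiv ℝ u x (XdirBox k j) ∂ν := by
  have := hν.isProbabilityMeasure
  simp only [Fsum, Finset.sum_mul]
  rw [integral_finsetSum, integral_finsetSum]
  · refine Finset.sum_congr rfl fun j hj => ?_
    rw [Finset.mem_Icc] at hj
    exact (hν.fShift_ibp ha hh hu (by omega) (by omega)).2
  · exact fun j _ => integrable_mul_fderiv ((ha.aAt k j).mul (hh.hWin k j)) hu _
  · intro j hj
    rw [Finset.mem_Icc] at hj
    exact (hν.fShift_ibp ha hh hu (by omega) (by omega)).1

end Canonical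

section Bounds

theorem aAt_mem {a : ℝ × ℝ × ℝ → ℝ} {astar : ℝ} (hbd : ∀ p, astar⁻¹ ≤ a p ∧ a p ≤ astar)
    (k : ℕ) (j : ℤ) (x : Fin (2 * k + 1) → ℝ) : astar⁻¹ ≤ aAt a k j x ∧ aAt a k j x ≤ astar :=
  hbd _

theorem card_Icc_neg_self {m : ℤ} (hm : 0 ≤ m) : ((Finset.Icc (-m) m).card : ℝ) = 2 * m + 1 := by
  rw [Int.card_Icc]
  have : ((m + 1 - -m).toNat : ℤ) = 2 * m + 1 := by omega
  exact_mod_cast this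

theorem floor_sub_sqrt_bounds {k s : ℕ} (hk : (s : ℝ) + 1 ≤ (k : ℝ) - Real.sqrt k) :
    0 ≤ ⌊(k : ℝ) - Real.sqrt k⌋ ∧ ⌊(k : ℝ) - Real.sqrt k⌋ ≤ (k : ℤ) - 1 ∧
      2 / 5 * (k : ℝ) ≤ 2 * (⌊(k : ℝ) - Real.sqrt k⌋ : ℝ) + 1 ∧ 0 < (k : ℝ) := by
  have hs : (0 : ℝ) ≤ s := s.cast_nonneg
  have hr0 := Real.sqrt_nonneg (k : ℝ)
  have hr2 := Real.sq_sqrt (Nat.cast_nonneg (α := ℝ) k)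
  have hk1 : (1 : ℝ) ≤ k := by linarith
  set r := Real.sqrt (k : ℝ)
  have hr1 : 1 ≤ r := by nlinarith
  have hm0 : (0 : ℤ) ≤ ⌊(k : ℝ) - r⌋ := Int.floor_nonneg.2 (by linarith)
  have hm1 : ⌊(k : ℝ) - r⌋ ≤ (k : ℤ) - 1 := by
    have : ⌊(k : ℝ) - r⌋ ≤ ⌊((k : ℤ) - 1 : ℤ)⌋ := by
      rw [← Int.floor_intCast (R := ℝ) ((k : ℤ) - 1)]
      exact Int.floor_mono (by push_cast; linarith)
    simpa using this
  refine ⟨hm0, hm1, ?_, by linarith⟩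
  have h3 := (Int.lt_floor_add_one ((k : ℝ) - r)).le
  have h4 : (1 : ℤ) ≤ ⌊(k : ℝ) - r⌋ := Int.le_floor.2 (by push_cast; linarith)
  have h5 : (1 : ℝ) ≤ (⌊(k : ℝ) - r⌋ : ℝ) := by exact_mod_cast h4
  nlinarith [sq_nonneg (r - 1)]

variable {k : ℕ} {y1 y2 : ℝ} {ν : Measure (Fin (2 * k + 1) → ℝ)}
  {a : ℝ × ℝ × ℝ → ℝ} {s : ℕ} {h : (Fin (2 * s + 1) → ℝ) → ℝ}

theorem integrable_dirichlet [IsFiniteMeasure ν] (ha : Bdd1 a) {u : (Fin (2 * k + 1) → ℝ) → ℝ}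
    (hu : Bdd1 u) (S : Finset ℤ) :
    Integrable (fun x => ∑ j ∈ S, aAt a k j x * (fderiv ℝ u x (XdirBox k j)) ^ 2) ν := by
  refine integrable_finsetSum _ fun j _ => ?_
  obtain ⟨N, hN⟩ := hu.exists_abs_fderiv_apply_le (XdirBox k j)
  refine ((integrable_mul_fderiv (ha.aAt k j) hu (XdirBox k j)).mul_continuous_bounded
    (hu.continuous_fderiv_apply (XdirBox k j)) hN).congr (Filter.Eventually.of_forall fun x => ?_)
  simp only
  ring

theorem VarSet_le {astar H : ℝ} (hastar : 1 ≤ astar) (ha : Bdd1 a)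
    (hbd : ∀ p, astar⁻¹ ≤ a p ∧ a p ≤ astar) (hh : Bdd1 h) (hH : ∀ p, |h p| ≤ H)
    (hk : (s : ℝ) + 1 ≤ (k : ℝ) - Real.sqrt k) (hν : IsCanonicalMeasure k y1 y2 ν)
    {r : ℝ} (hr : r ∈ VarSet a s h k ν) : r ≤ 6 * (astar * H ^ 2) := by
  obtain ⟨u, hu, hD, rfl⟩ := hr
  have hu : Bdd1 u := hu
  have := hν.isProbabilityMeasure
  obtain ⟨hm0, hm1, -, hk0⟩ := floor_sub_sqrt_bounds hk
  rw [hν.integral_Fsum_mul ha hh hu hm1]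
  have hcard := card_Icc_neg_self hm0
  set m := ⌊(k : ℝ) - Real.sqrt k⌋
  set D := dirichletForm a k ν u with hDdef
  set R := ∫ x, ∑ j ∈ Finset.Icc (-m) m,
    (aAt a k j x * hWin s h k j x) * fderiv ℝ u x (XdirBox k j) ∂ν with hR
  have hDint : ∫ x, ∑ j ∈ Finset.Icc (-(k : ℤ) + 1) ((k : ℤ) - 1),
      aAt a k j x * (fderiv ℝ u x (XdirBox k j)) ^ 2 ∂ν = 2 * D := by
    simp only [hDdef, dirichletForm, aAt]
    ring
  have ha0 : ∀ j x, 0 ≤ aAt a k j x := fun j x =>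
    (inv_nonneg.2 (by linarith)).trans (aAt_mem hbd k j x).1
  have key : ∀ t : ℝ, 2 * t * R ≤ (2 * m + 1) * (astar * H ^ 2) + t ^ 2 * (2 * D) := by
    intro t
    rw [hR, ← hDint, ← integral_const_mul, ← integral_const_mul]
    have i1 : Integrable (fun x => 2 * t * ∑ j ∈ Finset.Icc (-m) m,
        (aAt a k j x * hWin s h k j x) * fderiv ℝ u x (XdirBox k j)) ν :=
      (integrable_finsetSum _ fun j _ =>
        integrable_mul_fderiv ((ha.aAt k j).mul (hh.hWin k j)) hu _).const_mul _
    have i2 := (integrable_dirichlet (ν := ν) ha hu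
      (Finset.Icc (-(k : ℤ) + 1) ((k : ℤ) - 1))).const_mul (t ^ 2)
    have hconst : (2 * (m : ℝ) + 1) * (astar * H ^ 2)
        = ∫ _ : Fin (2 * k + 1) → ℝ, (2 * (m : ℝ) + 1) * (astar * H ^ 2) ∂ν := by simp
    rw [hconst, ← integral_add (integrable_const _) i2]
    refine integral_mono i1 ((integrable_const _).add i2) fun x => ?_
    simp only
    have hsub : ∑ j ∈ Finset.Icc (-m) m, aAt a k j x * (fderiv ℝ u x (XdirBox k j)) ^ 2
        ≤ ∑ j ∈ Finset.Icc (-(k : ℤ) + 1) ((k : ℤ) - 1),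
          aAt a k j x * (fderiv ℝ u x (XdirBox k j)) ^ 2 :=
      Finset.sum_le_sum_of_subset_of_nonneg (Finset.Icc_subset_Icc (by omega) hm1)
        fun j _ _ => mul_nonneg (ha0 j x) (sq_nonneg _)
    have hterm : ∑ j ∈ Finset.Icc (-m) m,
        2 * t * ((aAt a k j x * hWin s h k j x) * fderiv ℝ u x (XdirBox k j))
        ≤ ∑ j ∈ Finset.Icc (-m) m,
          (astar * H ^ 2 + t ^ 2 * (aAt a k j x * (fderiv ℝ u x (XdirBox k j)) ^ 2)) := by
      refine Finset.sum_le_sum fun j _ => ?_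
      have h1 : aAt a k j x * hWin s h k j x ^ 2 ≤ astar * H ^ 2 :=
        mul_le_mul (aAt_mem hbd k j x).2 (sq_le_sq.2 ((hH _).trans (le_abs_self H)))
          (sq_nonneg _) (by linarith)
      have h2 := mul_nonneg (ha0 j x)
        (sq_nonneg (hWin s h k j x - t * fderiv ℝ u x (XdirBox k j)))
      linarith
    rw [← Finset.mul_sum, Finset.sum_add_distrib, Finset.sum_const, nsmul_eq_mul, hcard,
      ← Finset.mul_sum] at hterm
    have := mul_le_mul_of_nonneg_left hsub (sq_nonneg t)
    linarith
  have hmk : (m : ℝ) ≤ k - 1 := by exact_mod_cast hm1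
  have hB : 0 ≤ astar * H ^ 2 := mul_nonneg (by linarith) (sq_nonneg _)
  have hkey := key (R / (2 * D))
  have e1 : 2 * (R / (2 * D)) * R = R ^ 2 / D := by field_simp
  have e2 : (R / (2 * D)) ^ 2 * (2 * D) = R ^ 2 / D / 2 := by field_simp
  rw [e1, e2] at hkey
  rw [mul_comm, ← div_div, div_le_iff₀ hk0]
  nlinarith

/-- The quadratic weights `Σ_i i²/2 · x_i`, on which every `X_j` acts as the constant `1`. -/
noncomputable def quadCLM (k : ℕ) : (Fin (2 * k + 1) → ℝ) →L[ℝ] ℝ :=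
  ∑ i : Fin (2 * k + 1), (((((i : ℕ) : ℤ) - k : ℤ) : ℝ) ^ 2 / 2) • ContinuousLinearMap.proj i

theorem quadCLM_XdirBox {k : ℕ} {j : ℤ} (h1 : -(k : ℤ) + 1 ≤ j) (h2 : j ≤ (k : ℤ) - 1) :
    quadCLM k (XdirBox k j) = 1 := by
  have h := sum_XdirBox_mul k j (fun i => ((((i : ℕ) : ℤ) - k : ℤ) : ℝ) ^ 2 / 2)
  rw [lapAt_of_formula (fun l => (l : ℝ) ^ 2 / 2) h1 h2] at h
  have e : quadCLM k (XdirBox k j)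
      = ∑ i, XdirBox k j i * (((((i : ℕ) : ℤ) - k : ℤ) : ℝ) ^ 2 / 2) := by
    simp [quadCLM, mul_comm]
  rw [e, h]
  push_cast
  ring

theorem bdd1_arctan : Bdd1 Real.arctan := by
  refine ⟨Real.contDiff_arctan, 2, fun x => ⟨?_, ?_⟩⟩
  · rw [abs_le]
    constructor <;> linarith [Real.neg_pi_div_two_lt_arctan x, Real.arctan_lt_pi_div_two x,
      Real.pi_lt_four]
  · rw [← norm_deriv_eq_norm_fderiv, Real.deriv_arctan, Real.norm_of_nonneg (by positivity)]
    refine (div_le_one₀ (by positivity)).2 ?_ |>.trans one_le_two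
    nlinarith [sq_nonneg x]

theorem fderiv_arctan_comp {E : Type*} [NormedAddCommGroup E] [NormedSpace ℝ E] (L : E →L[ℝ] ℝ)
    (x v : E) : fderiv ℝ (fun z => Real.arctan (L z)) x v = 1 / (1 + L x ^ 2) * L v := by
  rw [((L.hasFDerivAt (x := x)).arctan).fderiv]
  simp

theorem exists_integral_cauchy_weight_ge [IsProbabilityMeasure ν]
    (L : (Fin (2 * k + 1) → ℝ) →L[ℝ] ℝ) :
    ∃ b : ℝ, 0 < b ∧ 1 / 2 ≤ ∫ x, 1 / (1 + (b • L) x ^ 2) ∂ν := by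
  have hlim : Filter.Tendsto (fun n : ℕ => ∫ x, 1 / (1 + ((1 / ((n : ℝ) + 1)) • L) x ^ 2) ∂ν)
      Filter.atTop (nhds (∫ _ : Fin (2 * k + 1) → ℝ, (1 : ℝ) ∂ν)) := by
    refine tendsto_integral_of_dominated_convergence (fun _ => 1) (fun n => ?_)
      (integrable_const _) (fun n => Filter.Eventually.of_forall fun x => ?_)
      (Filter.Eventually.of_forall fun x => ?_)
    · refine Continuous.aestronglyMeasurable (continuous_const.div ?_ fun x => by positivity)
      fun_prop
    · rw [Real.norm_of_nonneg (by positivity)]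
      refine (div_le_one₀ (by positivity)).2 ?_
      nlinarith [sq_nonneg (((1 / ((n : ℝ) + 1)) • L) x)]
    · have h0 := (tendsto_one_div_add_atTop_nhds_zero_nat (𝕜 := ℝ)).mul_const (L x)
      have := ((h0.pow 2).const_add 1).inv₀ (by norm_num)
      simpa using this
  simp only [integral_const, probReal_univ, smul_eq_mul, mul_one] at hlim
  obtain ⟨n, hn⟩ := (hlim.eventually (lt_mem_nhds (by norm_num : (1 / 2 : ℝ) < 1))).exists
  exact ⟨1 / ((n : ℝ) + 1), by positivity, hn.le⟩

theorem exists_mem_VarSet_ge {astar c : ℝ} (hastar : 1 ≤ astar) (ha : Bdd1 a)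
    (hbd : ∀ p, astar⁻¹ ≤ a p ∧ a p ≤ astar) (hh : Bdd1 h) (hc : 0 < c) (hch : ∀ p, c ≤ h p)
    (hk : (s : ℝ) + 1 ≤ (k : ℝ) - Real.sqrt k) (hν : IsCanonicalMeasure k y1 y2 ν) :
    ∃ r ∈ VarSet a s h k ν, (astar⁻¹ * c) ^ 2 / astar / 50 ≤ r := by
  have := hν.isProbabilityMeasure
  obtain ⟨hm0, hm1, hmk, hk0⟩ := floor_sub_sqrt_bounds hk
  obtain ⟨b, hb, hI⟩ := exists_integral_cauchy_weight_ge (ν := ν) (quadCLM k)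
  have hu : Bdd1 fun x => Real.arctan ((b • quadCLM k) x) := bdd1_arctan.comp_clm _
  set w : (Fin (2 * k + 1) → ℝ) → ℝ := fun x => 1 / (1 + (b • quadCLM k) x ^ 2) with hw
  set u : (Fin (2 * k + 1) → ℝ) → ℝ := fun x => Real.arctan ((b • quadCLM k) x) with hudef
  have hw0 : ∀ x, 0 ≤ w x := fun x => by positivity
  have hw1 : ∀ x, w x ≤ 1 := fun x => by
    refine (div_le_one₀ (by positivity)).2 ?_
    nlinarith [sq_nonneg ((b • quadCLM k) x)]
  have hwc : Continuous w := continuous_const.div (by fun_prop) fun x => by positivity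
  have hwi : Integrable w ν :=
    integrable_of_continuous_of_abs_le hwc fun x => (abs_of_nonneg (hw0 x)).trans_le (hw1 x)
  have hX : ∀ x, ∀ j : ℤ, -(k : ℤ) + 1 ≤ j → j ≤ (k : ℤ) - 1 →
      fderiv ℝ u x (XdirBox k j) = w x * b := by
    intro x j h1 h2
    rw [hudef, fderiv_arctan_comp]
    simp [quadCLM_XdirBox h1 h2, hw]
  set I := ∫ x, w x ∂ν with hIdef
  have ha0 : 0 < astar⁻¹ := inv_pos.2 (by linarith)
  have hDint : ∫ x, ∑ j ∈ Finset.Icc (-(k : ℤ) + 1) ((k : ℤ) - 1),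
      aAt a k j x * (fderiv ℝ u x (XdirBox k j)) ^ 2 ∂ν = 2 * dirichletForm a k ν u := by
    simp only [dirichletForm, aAt]
    ring
  have hcardD : ((Finset.Icc (-(k : ℤ) + 1) ((k : ℤ) - 1)).card : ℝ) = 2 * k - 1 := by
    have := card_Icc_neg_self (m := (k : ℤ) - 1) (by omega)
    rw [neg_sub, sub_eq_add_neg 1, add_comm 1] at this
    rw [this]
    push_cast
    ring
  have hk1 : (1 : ℝ) ≤ k := by exact_mod_cast hk0
  have hDi := integrable_dirichlet (ν := ν) ha hu (Finset.Icc (-(k : ℤ) + 1) ((k : ℤ) - 1))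
  have hDle : 2 * dirichletForm a k ν u ≤ 2 * k * (astar * b ^ 2) * I := by
    rw [← hDint, hIdef, ← integral_const_mul]
    refine integral_mono hDi (hwi.const_mul _) fun x => ?_
    have : ∀ j ∈ Finset.Icc (-(k : ℤ) + 1) ((k : ℤ) - 1),
        aAt a k j x * (fderiv ℝ u x (XdirBox k j)) ^ 2 ≤ astar * b ^ 2 * w x := by
      intro j hj
      rw [Finset.mem_Icc] at hj
      rw [hX x j hj.1 hj.2]
      have h1 := (aAt_mem hbd k j x).2
      have h2 : (w x * b) ^ 2 ≤ b ^ 2 * w x := by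
        have : w x ^ 2 ≤ w x := by nlinarith [hw0 x, hw1 x]
        nlinarith [mul_le_mul_of_nonneg_left this (sq_nonneg b)]
      calc _ ≤ astar * (b ^ 2 * w x) := mul_le_mul h1 h2 (sq_nonneg _) (by linarith)
        _ = _ := by ring
    refine (Finset.sum_le_card_nsmul _ _ _ this).trans ?_
    rw [nsmul_eq_mul, hcardD]
    have : 0 ≤ astar * b ^ 2 * w x :=
      mul_nonneg (mul_nonneg (by linarith) (sq_nonneg _)) (hw0 x)
    linarith
  have hDpos : 0 < dirichletForm a k ν u := by
    have hlow : (2 * (k : ℝ) - 1) * (astar⁻¹ * b ^ 2) * (I - 1 / 4) ≤ 2 * dirichletForm a k ν u := by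
      have e : I - 1 / 4 = ∫ x, (w x - 1 / 4) ∂ν := by
        rw [integral_sub hwi (integrable_const _)]
        simp [hIdef]
      rw [← hDint, e, ← integral_const_mul]
      refine integral_mono ((hwi.sub (integrable_const _)).const_mul _) hDi fun x => ?_
      have : ∀ j ∈ Finset.Icc (-(k : ℤ) + 1) ((k : ℤ) - 1),
          astar⁻¹ * b ^ 2 * (w x - 1 / 4) ≤ aAt a k j x * (fderiv ℝ u x (XdirBox k j)) ^ 2 := by
        intro j hj
        rw [Finset.mem_Icc] at hj
        rw [hX x j hj.1 hj.2]
        have h1 := mul_le_mul_of_nonneg_right (aAt_mem hbd k j x).1 (sq_nonneg (w x * b))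
        have h2 : 0 ≤ astar⁻¹ * b ^ 2 * (w x - 1 / 2) ^ 2 := by positivity
        linarith
      have := Finset.card_nsmul_le_sum _ _ _ this
      rw [nsmul_eq_mul, hcardD] at this
      linarith
    have : 0 < (2 * (k : ℝ) - 1) * (astar⁻¹ * b ^ 2) * (I - 1 / 4) :=
      mul_pos (mul_pos (by linarith) (by positivity)) (by linarith)
    linarith
  refine ⟨_, ⟨u, hu, hDpos, rfl⟩, ?_⟩
  rw [hν.integral_Fsum_mul ha hh hu hm1]
  have hcard := card_Icc_neg_self hm0
  set m := ⌊(k : ℝ) - Real.sqrt k⌋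
  set R := ∫ x, ∑ j ∈ Finset.Icc (-m) m,
    (aAt a k j x * hWin s h k j x) * fderiv ℝ u x (XdirBox k j) ∂ν with hR
  have hRge : (2 * (m : ℝ) + 1) * (astar⁻¹ * c * b) * I ≤ R := by
    rw [hR, hIdef, ← integral_const_mul]
    refine integral_mono (hwi.const_mul _) (integrable_finsetSum _ fun j _ =>
        integrable_mul_fderiv ((ha.aAt k j).mul (hh.hWin k j)) hu _) fun x => ?_
    have : ∀ j ∈ Finset.Icc (-m) m, astar⁻¹ * c * b * w x
        ≤ (aAt a k j x * hWin s h k j x) * fderiv ℝ u x (XdirBox k j) := by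
      intro j hj
      rw [Finset.mem_Icc] at hj
      rw [hX x j (by omega) (by omega)]
      have h1 : astar⁻¹ * c ≤ aAt a k j x * hWin s h k j x :=
        mul_le_mul (aAt_mem hbd k j x).1 (hch _) hc.le (ha0.le.trans (aAt_mem hbd k j x).1)
      have := mul_le_mul_of_nonneg_right h1 (mul_nonneg (hw0 x) hb.le)
      linarith
    have := Finset.card_nsmul_le_sum _ _ _ this
    rw [nsmul_eq_mul, hcard] at this
    linarith
  have hI0 : 0 < I := by linarith
  have has : 0 < astar := by linarith
  have hq : 0 < astar⁻¹ * c := mul_pos ha0 hc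
  have hR' : 2 / 5 * k * (astar⁻¹ * c * b) * I ≤ R :=
    le_trans (by gcongr) hRge
  have hR2 : (2 / 5 * k * (astar⁻¹ * c * b) * I) ^ 2 ≤ R ^ 2 :=
    pow_le_pow_left₀ (by positivity) hR' 2
  rw [le_div_iff₀ (by positivity)]
  refine le_trans ?_ hR2
  have hkD : (k : ℝ) * dirichletForm a k ν u ≤ k * (k * (astar * b ^ 2) * I) := by
    gcongr
    linarith
  calc (astar⁻¹ * c) ^ 2 / astar / 50 * (k * dirichletForm a k ν u)
      ≤ (astar⁻¹ * c) ^ 2 / astar / 50 * (k * (k * (astar * b ^ 2) * I)) := by gcongr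
    _ = (1 / 50 * (k * (astar⁻¹ * c * b)) ^ 2) * I := by field_simp
    _ ≤ (1 / 50 * (k * (astar⁻¹ * c * b)) ^ 2) * (8 * I ^ 2) := by
        gcongr
        nlinarith
    _ = (2 / 5 * k * (astar⁻¹ * c * b) * I) ^ 2 := by ring

end Bounds

/-- **Uniform bounds on the central limit theorem variance.**
(i) There is `C(h) < ∞` with `𝕍_k(y) ≤ C(h)` for all `k` with `k − √k ≥ s+1` and all
`y ∈ ℝ²`; (ii) if moreover `h ≥ c > 0`, there is `C₁(h) > 0` with `𝕍_k(y) ≥ C₁(h)` for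
all such `k` and `y`. -/
theorem clt_variance_uniform_bounds
    (a : ℝ × ℝ × ℝ → ℝ) (astar : ℝ) (hastar : 1 ≤ astar)
    (ha : ContDiff ℝ 1 a) (hda : ∃ M : ℝ, ∀ p, ‖fderiv ℝ a p‖ ≤ M)
    (hbd : ∀ p, astar⁻¹ ≤ a p ∧ a p ≤ astar)
    (s : ℕ) (h : (Fin (2 * s + 1) → ℝ) → ℝ)
    (hh : ContDiff ℝ 1 h) (hhb : ∃ M : ℝ, ∀ p, |h p| ≤ M ∧ ‖fderiv ℝ h p‖ ≤ M) :
    (∃ C : ℝ, 0 < C ∧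
      ∀ (k : ℕ) (y1 y2 : ℝ) (ν : Measure (Fin (2 * k + 1) → ℝ)),
        (s : ℝ) + 1 ≤ (k : ℝ) - Real.sqrt k →
        IsCanonicalMeasure k y1 y2 ν →
        ∀ r ∈ VarSet a s h k ν, r ≤ C)
    ∧ ((∃ c : ℝ, 0 < c ∧ ∀ p, c ≤ h p) →
        ∃ C₁ : ℝ, 0 < C₁ ∧
          ∀ (k : ℕ) (y1 y2 : ℝ) (ν : Measure (Fin (2 * k + 1) → ℝ)),
            (s : ℝ) + 1 ≤ (k : ℝ) - Real.sqrt k →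
            IsCanonicalMeasure k y1 y2 ν →
            C₁ ≤ sSup (VarSet a s h k ν)) := by
  obtain ⟨H, hH⟩ := hhb
  obtain ⟨M, hM⟩ := hda
  have ha1 : Bdd1 a := by
    refine ⟨ha, max astar M, fun p => ⟨?_, (hM p).trans (le_max_right _ _)⟩⟩
    have h0 : 0 ≤ a p := (inv_nonneg.2 (by linarith)).trans (hbd p).1
    exact (abs_of_nonneg h0).trans_le ((hbd p).2.trans (le_max_left _ _))
  have hh1 : Bdd1 h := ⟨hh, H, hH⟩
  refine ⟨⟨6 * (astar * H ^ 2) + 1, by positivity, fun k y1 y2 ν hk hν r hr => ?_⟩, ?_⟩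
  · linarith [VarSet_le hastar ha1 hbd hh1 (fun p => (hH p).1) hk hν hr]
  · rintro ⟨c, hc, hch⟩
    refine ⟨(astar⁻¹ * c) ^ 2 / astar / 50, by positivity, fun k y1 y2 ν hk hν => ?_⟩
    obtain ⟨r, hr, hle⟩ := exists_mem_VarSet_ge hastar ha1 hbd hh1 hc hch hk hν
    exact hle.trans (le_csSup ⟨6 * (astar * H ^ 2), fun r' hr' =>
      VarSet_le hastar ha1 hbd hh1 (fun p => (hH p).1) hk hν hr'⟩ hr)
end
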